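/- Set K̂ = I − (q − q⁻¹)·MD, with underline copies K̂_{[1]} = K̂ ⊗ I^{⊗(n+p−1)}, K̂_{[r+1]} = R_r⁻¹ K̂_{[r]} R_r, and K̂_{[r→s]} = K̂_{[r]} K̂_{[r−1]} ⋯ K̂_{[s]} for r > s. Let J_s^{↑n} = R_{(n+s−1)→(n+1)} R_{(n+1)→(n+s−1)} (with J₁^{↑n} = I) denote the Jucys–Murphy matrices shifted by n positions. Then for all n, p ≥ 1, every entry of the matrix K̂_{[(n+p)→(n+1)]} · M_{⟨1→n⟩} − (∏_{i=1}^{p} J⁻¹_{n+i}) · (∏_{s=2}^{p} J_s^{↑n}) · M_{⟨1→n⟩} belongs to the left ideal of A generated by the entries of D. -/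

import Mathlib

open scoped BigOperators

noncomputable section

/-- One-site embedding of an `N×N` matrix into `Mat_{N^k}` at 0-based position `i`
(the paper's `X_{i+1}` in 1-based numbering).  Out of range we return the identity. -/
def matAt {α : Type*} [Semiring α] (N k : ℕ) (X : Matrix (Fin N) (Fin N) α) (i : ℕ) :
    Matrix (Fin k → Fin N) (Fin k → Fin N) α :=
  if h : i < k then
    Matrix.of fun a b =>
      if ∀ l : Fin k, (l : ℕ) ≠ i → a l = b l then X (a ⟨i, h⟩) (b ⟨i, h⟩) else 0
  else 1

/-- Two-site embedding of an operator on `V⊗V` into `Mat_{N^k}` at 0-based positions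
`i, i+1` (the paper's `R_{i+1}` in 1-based numbering). -/
def opAt {α : Type*} [Semiring α] (N k : ℕ)
    (R : Matrix (Fin N × Fin N) (Fin N × Fin N) α) (i : ℕ) :
    Matrix (Fin k → Fin N) (Fin k → Fin N) α :=
  if h : i + 1 < k then
    Matrix.of fun a b =>
      if ∀ l : Fin k, (l : ℕ) ≠ i → (l : ℕ) ≠ i + 1 → a l = b l then
        R (a ⟨i, by omega⟩, a ⟨i + 1, h⟩) (b ⟨i, by omega⟩, b ⟨i + 1, h⟩)
      else 0
  else 1

/-- A numeric (complex) matrix viewed inside `Mat(A)` via the unit of `A`. -/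
def toA (A : Type*) [Semiring A] [Algebra ℂ A] {ι : Type*} (X : Matrix ι ι ℂ) :
    Matrix ι ι A :=
  X.map (algebraMap ℂ A)

/-- The braid relation `R₁R₂R₁ = R₂R₁R₂` on `V^{⊗3}`. -/
def IsBraid (N : ℕ) (R : Matrix (Fin N × Fin N) (Fin N × Fin N) ℂ) : Prop :=
  opAt N 3 R 0 * opAt N 3 R 1 * opAt N 3 R 0 = opAt N 3 R 1 * opAt N 3 R 0 * opAt N 3 R 1

/-- The Hecke condition `(q·I − R)(q⁻¹·I + R) = 0`. -/
def IsHecke (N : ℕ) (q : ℂ) (R : Matrix (Fin N × Fin N) (Fin N × Fin N) ℂ) : Prop :=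
  (q • (1 : Matrix (Fin N × Fin N) (Fin N × Fin N) ℂ) - R) * (q⁻¹ • 1 + R) = 0

/-- `q` is generic: `q ∉ {0, 1, −1}` and `qⁿ ≠ 1` for all positive integers `n`. -/
def GenericQ (q : ℂ) : Prop :=
  q ≠ 0 ∧ q ≠ 1 ∧ q ≠ -1 ∧ ∀ n : ℕ, 0 < n → q ^ n ≠ 1

/-- The reflection-equation type relation `R X₁ R X₁ = X₁ R X₁ R` in `Mat_{N²}`. -/
def RErel {α : Type*} [Semiring α] (N : ℕ)
    (R : Matrix (Fin N × Fin N) (Fin N × Fin N) α) (X : Matrix (Fin N) (Fin N) α) : Prop :=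
  opAt N 2 R 0 * matAt N 2 X 0 * opAt N 2 R 0 * matAt N 2 X 0 =
    matAt N 2 X 0 * opAt N 2 R 0 * matAt N 2 X 0 * opAt N 2 R 0

/-- The quantum-double permutation relation `D₁ R M₁ R = R M₁ R⁻¹ D₁ + R` in `Mat_{N²}(A)`. -/
def PermRel {A : Type*} [Ring A] [Algebra ℂ A] (N : ℕ)
    (R Rinv : Matrix (Fin N × Fin N) (Fin N × Fin N) ℂ)
    (M D : Matrix (Fin N) (Fin N) A) : Prop :=
  matAt N 2 D 0 * opAt N 2 (toA A R) 0 * matAt N 2 M 0 * opAt N 2 (toA A R) 0 =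
    opAt N 2 (toA A R) 0 * matAt N 2 M 0 * opAt N 2 (toA A Rinv) 0 * matAt N 2 D 0 +
      opAt N 2 (toA A R) 0

/-- The homogeneous permutation relation `D₁ R M₁ R = R M₁ R⁻¹ D₁` in `Mat_{N²}(A)`. -/
def PermRelHom {A : Type*} [Ring A] [Algebra ℂ A] (N : ℕ)
    (R Rinv : Matrix (Fin N × Fin N) (Fin N × Fin N) ℂ)
    (M D : Matrix (Fin N) (Fin N) A) : Prop :=
  matAt N 2 D 0 * opAt N 2 (toA A R) 0 * matAt N 2 M 0 * opAt N 2 (toA A R) 0 =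
    opAt N 2 (toA A R) 0 * matAt N 2 M 0 * opAt N 2 (toA A Rinv) 0 * matAt N 2 D 0

/-- Overline copies: `ovCopy … r = X_{⟨r+1⟩}`, i.e. `X_{⟨1⟩} = X⊗I⊗⋯⊗I` and
`X_{⟨r+1⟩} = R_r X_{⟨r⟩} R_r⁻¹`. -/
def ovCopy {α : Type*} [Semiring α] (N k : ℕ)
    (R Rinv : Matrix (Fin N × Fin N) (Fin N × Fin N) α)
    (X : Matrix (Fin N) (Fin N) α) : ℕ → Matrix (Fin k → Fin N) (Fin k → Fin N) α
  | 0 => matAt N k X 0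
  | r + 1 => opAt N k R r * ovCopy N k R Rinv X r * opAt N k Rinv r

/-- Underline copies: `unCopy … r = X_{[r+1]}`, i.e. `X_{[1]} = X⊗I⊗⋯⊗I` and
`X_{[r+1]} = R_r⁻¹ X_{[r]} R_r`. -/
def unCopy {α : Type*} [Semiring α] (N k : ℕ)
    (R Rinv : Matrix (Fin N × Fin N) (Fin N × Fin N) α)
    (X : Matrix (Fin N) (Fin N) α) : ℕ → Matrix (Fin k → Fin N) (Fin k → Fin N) α
  | 0 => matAt N k X 0
  | r + 1 => opAt N k Rinv r * unCopy N k R Rinv X r * opAt N k R r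

/-- `X_{⟨1→n⟩} = X_{⟨1⟩}X_{⟨2⟩}⋯X_{⟨n⟩}`. -/
def ovProd {α : Type*} [Semiring α] (N k : ℕ)
    (R Rinv : Matrix (Fin N × Fin N) (Fin N × Fin N) α)
    (X : Matrix (Fin N) (Fin N) α) (n : ℕ) : Matrix (Fin k → Fin N) (Fin k → Fin N) α :=
  ((List.range n).map (ovCopy N k R Rinv X)).prod

/-- `X_{⟨n→1⟩} = X_{⟨n⟩}X_{⟨n−1⟩}⋯X_{⟨1⟩}`. -/
def ovProdRev {α : Type*} [Semiring α] (N k : ℕ)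
    (R Rinv : Matrix (Fin N × Fin N) (Fin N × Fin N) α)
    (X : Matrix (Fin N) (Fin N) α) (n : ℕ) : Matrix (Fin k → Fin N) (Fin k → Fin N) α :=
  ((List.range n).reverse.map (ovCopy N k R Rinv X)).prod

/-- Shifted Jucys–Murphy matrices: `JMup … R n s = J_{s+1}^{↑n}`, i.e. `J₁^{↑n} = I` and
`J_{s+1}^{↑n} = R_{n+s} J_s^{↑n} R_{n+s}` (paper's 1-based `R_{n+s}` is `opAt … (n+s-1)`).
Applying it to `R⁻¹` produces `(J_{s+1}^{↑n})⁻¹`. -/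
def JMup {α : Type*} [Semiring α] (N k : ℕ)
    (R : Matrix (Fin N × Fin N) (Fin N × Fin N) α) (n : ℕ) :
    ℕ → Matrix (Fin k → Fin N) (Fin k → Fin N) α
  | 0 => 1
  | s + 1 => opAt N k R (n + s) * JMup N k R n s * opAt N k R (n + s)

/-- The quantum trace `Tr_{R(1…n)}(X) = Tr(C₁C₂⋯C_n X)`. -/
def qTr {α : Type*} [Semiring α] (N n : ℕ) (C : Matrix (Fin N) (Fin N) α)
    (X : Matrix (Fin n → Fin N) (Fin n → Fin N) α) : α :=
  Matrix.trace (((List.range n).map (matAt N n C)).prod * X)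

/-- The matrix `C`, `C_i^j = Σ_k Ψ_{ik}^{jk}`. -/
def traceMat (N : ℕ) (Ψ : Matrix (Fin N × Fin N) (Fin N × Fin N) ℂ) :
    Matrix (Fin N) (Fin N) ℂ :=
  Matrix.of fun i j => ∑ k, Ψ (i, k) (j, k)

/-- Skew-invertibility of `R`: `Tr₂(R₁₂Ψ₂₃) = Tr₂(Ψ₁₂R₂₃) = P₁₃`, written componentwise. -/
def SkewInv (N : ℕ) (R Ψ : Matrix (Fin N × Fin N) (Fin N × Fin N) ℂ) : Prop :=
  (∀ i k l n : Fin N, ∑ j, ∑ b, R (i, j) (l, b) * Ψ (b, k) (j, n) =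
      if i = n ∧ k = l then 1 else 0) ∧
  (∀ i k l n : Fin N, ∑ j, ∑ b, Ψ (i, j) (l, b) * R (b, k) (j, n) =
      if i = n ∧ k = l then 1 else 0)

/-- The generators `R₁, …, R_{n−1}` (1-based) of the Hecke-algebra image inside
`End(V^{⊗k})`, as a subset of `Mat_{N^k}`. -/
def genSet {α : Type*} [Semiring α] (N k n : ℕ)
    (R : Matrix (Fin N × Fin N) (Fin N × Fin N) α) :
    Set (Matrix (Fin k → Fin N) (Fin k → Fin N) α) :=
  {X | ∃ i : ℕ, i + 1 < n ∧ X = opAt N k R i}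

/-- The left ideal of `A` generated by the entries of `D`. -/
def entryIdeal (A : Type*) [Ring A] {N : ℕ} (D : Matrix (Fin N) (Fin N) A) :
    Submodule A A :=
  Submodule.span A {x : A | ∃ i j : Fin N, x = D i j}

/-- The normally ordered monomial `:L̂_{⟨1→k⟩}: = M_{⟨1→k⟩} D_{⟨k→1⟩} ∏_{s=1}^{k} J_s⁻¹`. -/
def normOrd {α : Type*} [Semiring α] (N k : ℕ)
    (R Rinv : Matrix (Fin N × Fin N) (Fin N × Fin N) α)
    (M D : Matrix (Fin N) (Fin N) α) (n : ℕ) :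
    Matrix (Fin k → Fin N) (Fin k → Fin N) α :=
  ovProd N k R Rinv M n * ovProdRev N k R Rinv D n *
    ((List.range n).map (fun s => JMup N k Rinv 0 s)).prod

/-- The recursion `x₀ = x`, `x_{t+1} = u_t x_t v_t`, of which overline copies, underline copies
and Jucys–Murphy elements are instances. -/
def sandwich {S : Type*} [Mul S] (u v : ℕ → S) (x : S) : ℕ → S
  | 0 => x
  | t + 1 => u t * sandwich u v x t * v t

/-- Invertible elements `r 0, …, r (k - 2)` satisfying the braid relations, with inverses `ri`. -/
structure BraidSystem {S : Type*} [Monoid S] (k : ℕ) (r ri : ℕ → S) : Prop where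
  mul_inv : ∀ i, r i * ri i = 1
  inv_mul : ∀ i, ri i * r i = 1
  far : ∀ i j, i + 1 < j → Commute (r i) (r j)
  braid : ∀ i, i + 2 < k → r i * r (i + 1) * r i = r (i + 1) * r i * r (i + 1)

lemma Commute.of_mul_eq_one {S : Type*} [Monoid S] {x a b : S} (h : Commute x a)
    (hab : a * b = 1) (hba : b * a = 1) : Commute x b := by
  have : Commute x ((⟨a, b, hab, hba⟩ : Sˣ) : S) := h
  exact this.units_inv_right

lemma commute_sandwich {S : Type*} [Monoid S] {u v : ℕ → S} {x y : S} (hx : Commute y x)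
    (t : ℕ) (hu : ∀ i < t, Commute y (u i)) (hv : ∀ i < t, Commute y (v i)) :
    Commute y (sandwich u v x t) := by
  induction t with
  | zero => exact hx
  | succ t ih =>
    exact ((hu t (by omega)).mul_right (ih (fun i hi => hu i (by omega))
      (fun i hi => hv i (by omega)))).mul_right (hv t (by omega))

lemma commute_list_map_prod {S : Type*} [Monoid S] {y : S} (l : List ℕ) (f : ℕ → S)
    (h : ∀ i ∈ l, Commute y (f i)) : Commute y (l.map f).prod := by
  apply Commute.list_prod_right
  intro z hz
  obtain ⟨i, hi, rfl⟩ := List.mem_map.1 hz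
  exact h i hi

namespace BraidSystem

variable {S : Type*}

section Monoid

variable [Monoid S] {k : ℕ} {r ri : ℕ → S}

lemma far_inv (h : BraidSystem k r ri) (i j : ℕ) (hij : i + 1 < j) : Commute (r j) (ri i) :=
  (h.far i j hij).symm.of_mul_eq_one (h.mul_inv i) (h.inv_mul i)

lemma inv_far (h : BraidSystem k r ri) (i j : ℕ) (hij : i + 1 < j) : Commute (r i) (ri j) :=
  (h.far i j hij).of_mul_eq_one (h.mul_inv j) (h.inv_mul j)

lemma mul_inv_inv (h : BraidSystem k r ri) (i : ℕ) (hi : i + 2 < k) :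
    r i * (ri (i + 1) * ri i) = ri (i + 1) * ri i * r (i + 1) := by
  calc r i * (ri (i + 1) * ri i)
      = ri (i + 1) * ri i * (r i * r (i + 1) * r i) * ri (i + 1) * ri i := by
        simp only [mul_assoc, ← mul_assoc (ri i) (r i), h.inv_mul, one_mul,
          ← mul_assoc (ri (i + 1)) (r (i + 1))]
    _ = _ := by
        rw [h.braid i hi]
        simp only [mul_assoc, h.mul_inv, mul_one]

lemma mul_inv_inv' (h : BraidSystem k r ri) (i : ℕ) (hi : i + 2 < k) :
    r (i + 1) * (ri i * ri (i + 1)) = ri i * ri (i + 1) * r i := by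
  calc r (i + 1) * (ri i * ri (i + 1))
      = ri i * ri (i + 1) * (r (i + 1) * r i * r (i + 1)) * ri i * ri (i + 1) := by
        simp only [mul_assoc, ← mul_assoc (ri i) (r i), h.inv_mul, one_mul,
          ← mul_assoc (ri (i + 1)) (r (i + 1))]
    _ = _ := by
        rw [← h.braid i hi]
        simp only [mul_assoc, h.mul_inv, mul_one]

lemma inv_mul_mul (h : BraidSystem k r ri) (i : ℕ) (hi : i + 2 < k) :
    ri i * r (i + 1) * r i = r (i + 1) * r i * ri (i + 1) := by
  calc ri i * r (i + 1) * r i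
      = ri i * (r (i + 1) * r i * r (i + 1)) * ri (i + 1) := by
        simp only [mul_assoc, h.mul_inv, mul_one]
    _ = _ := by
        rw [← h.braid i hi]
        simp only [mul_assoc, ← mul_assoc (ri i) (r i), h.inv_mul, one_mul]

lemma inv_mul_mul' (h : BraidSystem k r ri) (i : ℕ) (hi : i + 2 < k) :
    ri (i + 1) * r i * r (i + 1) = r i * r (i + 1) * ri i := by
  calc ri (i + 1) * r i * r (i + 1)
      = ri (i + 1) * (r i * r (i + 1) * r i) * ri i := by
        simp only [mul_assoc, h.mul_inv, mul_one]
    _ = _ := by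
        rw [h.braid i hi]
        simp only [mul_assoc, ← mul_assoc (ri (i + 1)) (r (i + 1)), h.inv_mul, one_mul]

lemma inv_inv_mul (h : BraidSystem k r ri) (i : ℕ) (hi : i + 2 < k) :
    ri (i + 1) * ri i * r (i + 1) = r i * (ri (i + 1) * ri i) := (h.mul_inv_inv i hi).symm

/-- The generators far to the right commute with a conjugation recursion. -/
lemma commute_right (h : BraidSystem k r ri) {u v : ℕ → S} {x : S}
    (hx : ∀ i, 1 ≤ i → Commute (r i) x) (hu : u = r ∨ u = ri) (hv : v = r ∨ v = ri)
    {t j : ℕ} (htj : t < j) : Commute (r j) (sandwich u v x t) := by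
  have key : ∀ w : ℕ → S, w = r ∨ w = ri → ∀ i < t, Commute (r j) (w i) := by
    rintro w (rfl | rfl) i hi
    · exact (h.far i j (by omega)).symm
    · exact h.far_inv i j (by omega)
  exact commute_sandwich (hx j (by omega)) t (key u hu) (key v hv)

lemma commute_left (h : BraidSystem k r ri) {v : ℕ → S} {x : S}
    (hx : ∀ i, 1 ≤ i → Commute (r i) x) (hv : v = r ∨ v = ri)
    {t i : ℕ} (hit : i + 1 < t) (htk : t < k) : Commute (r i) (sandwich ri v x t) := by
  induction t with
  | zero => omega
  | succ t ih =>
    rcases Nat.lt_or_ge (i + 1) t with hlt | hge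
    · refine ((h.inv_far i t hlt).mul_right (ih hlt (by omega))).mul_right ?_
      rcases hv with rfl | rfl
      · exact h.far i t hlt
      · exact h.inv_far i t hlt
    · obtain rfl : t = i + 1 := by omega
      have hfar : Commute (r (i + 1)) (sandwich ri v x i) :=
        h.commute_right hx (Or.inr rfl) hv (by omega)
      have hl := h.mul_inv_inv i (by omega)
      have hr : r (i + 1) * (v i * v (i + 1)) = v i * v (i + 1) * r i := by
        rcases hv with rfl | rfl
        · rw [← mul_assoc, h.braid i (by omega)]
        · exact h.mul_inv_inv' i (by omega)
      change r i * (ri (i + 1) * (ri i * sandwich ri v x i * v i) * v (i + 1)) =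
        ri (i + 1) * (ri i * sandwich ri v x i * v i) * v (i + 1) * r i
      calc _ = r i * (ri (i + 1) * ri i) * sandwich ri v x i * (v i * v (i + 1)) := by
            simp only [mul_assoc]
        _ = ri (i + 1) * ri i * (r (i + 1) * sandwich ri v x i) * (v i * v (i + 1)) := by
            rw [hl]; simp only [mul_assoc]
        _ = ri (i + 1) * ri i * sandwich ri v x i * (r (i + 1) * (v i * v (i + 1))) := by
            rw [hfar.eq]; simp only [mul_assoc]
        _ = _ := by rw [hr]; simp only [mul_assoc]

/-- The exchange relation between the first copies of `κ` and `m` shifts to all copies. -/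
lemma shift_rel (h : BraidSystem k r ri) {m κ : S} (hm : ∀ i, 1 ≤ i → Commute (r i) m)
    (hκ : ∀ i, 1 ≤ i → Commute (r i) κ) (hrel : κ * r 0 * m * r 0 = ri 0 * m * r 0 * κ)
    (n : ℕ) (hn : n + 1 < k) :
    sandwich r ri κ n * r n * sandwich r ri m n * r n =
      ri n * sandwich r ri m n * r n * sandwich r ri κ n := by
  induction n with
  | zero => exact hrel
  | succ n ih =>
    have ih := ih (by omega)
    simp only [sandwich]
    have hK : Commute (r (n + 1)) (sandwich r ri κ n) :=
      h.commute_right hκ (Or.inl rfl) (Or.inr rfl) (by omega)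
    have hM : Commute (r (n + 1)) (sandwich r ri m n) :=
      h.commute_right hm (Or.inl rfl) (Or.inr rfl) (by omega)
    have hK' := (hK.symm.of_mul_eq_one (h.mul_inv _) (h.inv_mul _)).eq
    have hM' := (hM.symm.of_mul_eq_one (h.mul_inv _) (h.inv_mul _)).eq
    generalize sandwich r ri κ n = K at *
    generalize sandwich r ri m n = X at *
    calc _ = r n * K * (ri n * r (n + 1) * r n) * X * ri n * r (n + 1) := by
          simp only [mul_assoc]
      _ = r n * (r (n + 1) * K) * r n * (X * ri (n + 1)) * ri n * r (n + 1) := by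
          rw [h.inv_mul_mul n (by omega), hM', hK.eq]; simp only [mul_assoc]
      _ = r n * r (n + 1) * K * r n * X * (ri (n + 1) * ri n * r (n + 1)) := by
          simp only [mul_assoc]
      _ = r n * r (n + 1) * (K * r n * X * r n) * ri (n + 1) * ri n := by
          rw [h.inv_inv_mul n (by omega)]; simp only [mul_assoc]
      _ = (r n * r (n + 1) * ri n) * X * r n * (K * ri (n + 1)) * ri n := by
          rw [ih]; simp only [mul_assoc]
      _ = ri (n + 1) * r n * (r (n + 1) * X) * r n * ri (n + 1) * K * ri n := by
          rw [← h.inv_mul_mul' n (by omega), hK']; simp only [mul_assoc]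
      _ = ri (n + 1) * r n * X * (r (n + 1) * r n * ri (n + 1)) * K * ri n := by
          rw [hM.eq]; simp only [mul_assoc]
      _ = _ := by
          rw [← h.inv_mul_mul n (by omega)]; simp only [mul_assoc]

lemma commute_prod (h : BraidSystem k r ri) {m : S} (hm : ∀ i, 1 ≤ i → Commute (r i) m)
    {n j : ℕ} (hnj : n ≤ j) :
    Commute (r j) ((List.range n).map (sandwich r ri m)).prod :=
  commute_list_map_prod _ _ fun i hi =>
    h.commute_right hm (Or.inl rfl) (Or.inr rfl) (by have := List.mem_range.1 hi; omega)

/-- Moving an underline copy of `κ` through a product of overline copies of `m`. -/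
lemma unCopy_mul_prod (h : BraidSystem k r ri) {m κ : S} (hm : ∀ i, 1 ≤ i → Commute (r i) m)
    (hκ : ∀ i, 1 ≤ i → Commute (r i) κ) (hrel : κ * r 0 * m * r 0 = ri 0 * m * r 0 * κ)
    (n : ℕ) (hn : n < k) :
    sandwich ri r κ n * ((List.range n).map (sandwich r ri m)).prod =
      sandwich ri ri 1 n * ((List.range n).map (sandwich r ri m)).prod * sandwich r ri κ n := by
  induction n with
  | zero => simp [sandwich]
  | succ n ih =>
    have ih := ih (by omega)
    have hP := h.commute_prod hm (le_refl n)
    have hP' := (hP.symm.of_mul_eq_one (h.mul_inv _) (h.inv_mul _)).eq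
    have hs := h.shift_rel hm hκ hrel n hn
    have hs' : sandwich r ri κ n * r n * sandwich r ri m n =
        ri n * sandwich r ri m n * r n * sandwich r ri κ n * ri n := by
      rw [← hs, mul_assoc _ (r n) (ri n), h.mul_inv, mul_one]
    rw [List.range_succ, List.map_append, List.prod_append, List.map_singleton,
      List.prod_singleton]
    simp only [sandwich]
    generalize ((List.range n).map (sandwich r ri m)).prod = P at *
    calc _ = ri n * sandwich ri r κ n * (r n * P) * sandwich r ri m n := by
          simp only [mul_assoc]
      _ = ri n * (sandwich ri r κ n * P) * r n * sandwich r ri m n := by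
          rw [hP.eq]; simp only [mul_assoc]
      _ = ri n * sandwich ri ri 1 n * P * (sandwich r ri κ n * r n * sandwich r ri m n) := by
          rw [ih]; simp only [mul_assoc]
      _ = ri n * sandwich ri ri 1 n * (P * ri n) *
            (sandwich r ri m n * r n * sandwich r ri κ n * ri n) := by
          rw [hs']; simp only [mul_assoc]
      _ = _ := by rw [hP']; simp only [mul_assoc]

end Monoid

section Ring

variable [Ring S] {k : ℕ} {r ri : ℕ → S}

/-- Overline copies of an element congruent to `1` modulo a left ideal are congruent to `1`. -/
lemma ovCopy_sub_one_mem (h : BraidSystem k r ri) (J : Ideal S)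
    (hJi : ∀ x ∈ J, ∀ i, x * ri i ∈ J) {κ : S} (hκ : κ - 1 ∈ J) (n : ℕ) :
    sandwich r ri κ n - 1 ∈ J := by
  induction n with
  | zero => exact hκ
  | succ n ih =>
    have := hJi _ (J.mul_mem_left (r n) ih) n
    rwa [mul_sub, sub_mul, mul_one, h.mul_inv] at this

lemma unCopy_mul_prod_mem (h : BraidSystem k r ri) (J : Ideal S)
    (hJ : ∀ x ∈ J, ∀ i, x * r i ∈ J) (hJi : ∀ x ∈ J, ∀ i, x * ri i ∈ J)
    {m κ : S} (hκ1 : κ - 1 ∈ J) (hm : ∀ i, 1 ≤ i → Commute (r i) m)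
    (hκ : ∀ i, 1 ≤ i → Commute (r i) κ) (hrel : κ * r 0 * m * r 0 = ri 0 * m * r 0 * κ)
    (n s : ℕ) (hn : n + s < k) :
    sandwich ri r κ (n + s) * ((List.range n).map (sandwich r ri m)).prod -
      sandwich ri ri 1 (n + s) * sandwich (fun i => r (n + i)) (fun i => r (n + i)) 1 s *
        ((List.range n).map (sandwich r ri m)).prod ∈ J := by
  induction s with
  | zero =>
    have := J.mul_mem_left (sandwich ri ri 1 n * ((List.range n).map (sandwich r ri m)).prod)
      (h.ovCopy_sub_one_mem J hJi hκ1 n)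
    rw [mul_sub, ← h.unCopy_mul_prod hm hκ hrel n hn, mul_one] at this
    simpa [sandwich] using this
  | succ s ih =>
    have ih := hJ _ (J.mul_mem_left (ri (n + s)) (ih (by omega))) (n + s)
    have hP := h.commute_prod hm (Nat.le_add_right n s)
    rw [← add_assoc]
    simp only [sandwich]
    generalize ((List.range n).map (sandwich r ri m)).prod = P at *
    convert ih using 1
    generalize sandwich (fun i => r (n + i)) (fun i => r (n + i)) 1 s = Y
    rw [mul_sub, sub_mul]
    simp only [mul_assoc]
    rw [← hP.eq, ← mul_assoc (ri (n + s)) (r (n + s)), h.inv_mul, one_mul]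

lemma prod_unCopy_mul_prod_mem (h : BraidSystem k r ri) (J : Ideal S)
    (hJ : ∀ x ∈ J, ∀ i, x * r i ∈ J) (hJi : ∀ x ∈ J, ∀ i, x * ri i ∈ J)
    {m κ : S} (hκ1 : κ - 1 ∈ J) (hm : ∀ i, 1 ≤ i → Commute (r i) m)
    (hκ : ∀ i, 1 ≤ i → Commute (r i) κ) (hrel : κ * r 0 * m * r 0 = ri 0 * m * r 0 * κ)
    (n p : ℕ) (hn : n + p ≤ k) :
    ((List.range' n p).reverse.map (sandwich ri r κ)).prod *
        ((List.range n).map (sandwich r ri m)).prod -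
      ((List.range p).map (fun i => sandwich ri ri 1 (n + i))).prod *
        ((List.range p).map (sandwich (fun i => r (n + i)) (fun i => r (n + i)) 1)).prod *
        ((List.range n).map (sandwich r ri m)).prod ∈ J := by
  induction p with
  | zero => simp
  | succ p ih =>
    have hU : ∀ i, i + 1 < n + p → Commute (sandwich ri r κ (n + p)) (r i) := fun i hi =>
      (h.commute_left hκ (Or.inl rfl) hi (by omega)).symm
    have hUi : ∀ i, i + 1 < n + p → Commute (sandwich ri r κ (n + p)) (ri i) := fun i hi =>
      (hU i hi).of_mul_eq_one (h.mul_inv _) (h.inv_mul _)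
    have hL : ∀ i, i + 1 < n + p → Commute (sandwich ri ri 1 (n + p)) (r i) := fun i hi =>
      (h.commute_left (fun _ _ => Commute.one_right _) (Or.inr rfl) hi (by omega)).symm
    have hUA : Commute (sandwich ri r κ (n + p))
        ((List.range p).map (fun i => sandwich ri ri 1 (n + i))).prod :=
      commute_list_map_prod _ _ fun i hi => by
        have := List.mem_range.1 hi
        exact commute_sandwich (Commute.one_right _) _ (fun j hj => hUi j (by omega))
          (fun j hj => hUi j (by omega))
    have hB : ∀ z, (∀ i, i + 1 < n + p → Commute z (r i)) → Commute z
        ((List.range p).map (sandwich (fun i => r (n + i)) (fun i => r (n + i)) 1)).prod :=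
      fun z hz => commute_list_map_prod _ _ fun i hi => by
        have := List.mem_range.1 hi
        exact commute_sandwich (Commute.one_right _) _ (fun j hj => hz _ (by omega))
          (fun j hj => hz _ (by omega))
    have hUB := hB _ hU
    have hLB := hB _ hL
    have h1 := J.mul_mem_left (sandwich ri r κ (n + p)) (ih (by omega))
    have h2 := h.unCopy_mul_prod_mem J hJ hJi hκ1 hm hκ hrel n p (by omega)
    rw [List.range'_1_concat, List.reverse_append, List.map_append, List.prod_append,
      List.range_succ, List.map_append, List.prod_append, List.map_append, List.prod_append]
    simp only [List.reverse_singleton, List.map_singleton, List.prod_singleton]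
    generalize ((List.range n).map (sandwich r ri m)).prod = P at *
    generalize ((List.range p).map (fun i => sandwich ri ri 1 (n + i))).prod = X at *
    generalize ((List.range p).map
      (sandwich (fun i => r (n + i)) (fun i => r (n + i)) 1)).prod = Y at *
    have h3 := J.add_mem h1 (J.mul_mem_left (X * Y) h2)
    convert h3 using 1
    have e1 : sandwich ri r κ (n + p) * (X * Y * P) = X * Y * (sandwich ri r κ (n + p) * P) := by
      rw [← mul_assoc, (hUA.mul_right hUB).eq, mul_assoc]
    rw [mul_sub, mul_sub, e1]
    simp only [mul_assoc]
    rw [← mul_assoc (sandwich ri ri 1 (n + p)) Y, hLB.eq]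
    simp only [mul_assoc]
    abel

end Ring

end BraidSystem

section Window

variable {α : Type*} [Semiring α] {N k : ℕ}

/-- Splitting an index tuple into its part in the window `[off, off + w)` and the rest. -/
def windowEquiv (N : ℕ) {k off w : ℕ} (h : off + w ≤ k) :
    (Fin k → Fin N) ≃
      (Fin w → Fin N) × ({l : Fin k // ¬ (off ≤ (l : ℕ) ∧ (l : ℕ) < off + w)} → Fin N) where
  toFun a := (fun j => a ⟨off + j, by omega⟩, fun l => a l)
  invFun x := fun l =>
    if hl : off ≤ (l : ℕ) ∧ (l : ℕ) < off + w then x.1 ⟨l - off, by omega⟩ else x.2 ⟨l, hl⟩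
  left_inv a := by
    funext l
    dsimp only
    split_ifs with hl
    · congr 1
      ext
      dsimp only
      omega
    · rfl
  right_inv x := by
    refine Prod.ext ?_ ?_
    · funext j
      simp
    · funext l
      simp only [dif_neg l.2]

/-- The embedding of operators on `w` sites as operators on the sites `[off, off + w)`. -/
def windowEmb {off w : ℕ} (h : off + w ≤ k) (X : Matrix (Fin w → Fin N) (Fin w → Fin N) α) :
    Matrix (Fin k → Fin N) (Fin k → Fin N) α :=
  (Matrix.blockDiagonal fun _ => X).submatrix (windowEquiv N h) (windowEquiv N h)

lemma windowEmb_apply {off w : ℕ} (h : off + w ≤ k)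
    (X : Matrix (Fin w → Fin N) (Fin w → Fin N) α) (a b : Fin k → Fin N) :
    windowEmb h X a b =
      if ∀ l : Fin k, ¬ (off ≤ (l : ℕ) ∧ (l : ℕ) < off + w) → a l = b l then
        X (fun j => a ⟨off + j, by omega⟩) (fun j => b ⟨off + j, by omega⟩) else 0 := by
  simp only [windowEmb, Matrix.submatrix_apply, Matrix.blockDiagonal_apply]
  refine if_congr ?_ rfl rfl
  rw [funext_iff]
  exact ⟨fun H l hl => H ⟨l, hl⟩, fun H l => H l l.2⟩

lemma windowEmb_mul {off w : ℕ} (h : off + w ≤ k)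
    (X Y : Matrix (Fin w → Fin N) (Fin w → Fin N) α) :
    windowEmb h (X * Y) = windowEmb h X * windowEmb h Y := by
  simp only [windowEmb, Matrix.submatrix_mul_equiv, ← Matrix.blockDiagonal_mul]

lemma windowEmb_add {off w : ℕ} (h : off + w ≤ k)
    (X Y : Matrix (Fin w → Fin N) (Fin w → Fin N) α) :
    windowEmb h (X + Y) = windowEmb h X + windowEmb h Y := by
  ext a b
  simp only [windowEmb_apply, Matrix.add_apply]
  split_ifs <;> simp

lemma windowEmb_one {off w : ℕ} (h : off + w ≤ k) :
    windowEmb h (1 : Matrix (Fin w → Fin N) (Fin w → Fin N) α) = 1 := by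
  simp only [windowEmb]
  rw [show (fun _ : {l : Fin k // ¬ (off ≤ (l : ℕ) ∧ (l : ℕ) < off + w)} → Fin N =>
    (1 : Matrix (Fin w → Fin N) (Fin w → Fin N) α)) = 1 from rfl, Matrix.blockDiagonal_one,
    Matrix.submatrix_one_equiv]

lemma windowEmb_opAt {off w : ℕ} (h : off + w ≤ k)
    (R : Matrix (Fin N × Fin N) (Fin N × Fin N) α) {j : ℕ} (hj : j + 1 < w) :
    windowEmb h (opAt N w R j) = opAt N k R (off + j) := by
  ext a b
  rw [windowEmb_apply, opAt, opAt, dif_pos hj, dif_pos (by omega)]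
  simp only [Matrix.of_apply]
  by_cases H : ∀ l : Fin k, (l : ℕ) ≠ off + j → (l : ℕ) ≠ off + j + 1 → a l = b l
  · rw [if_pos H, if_pos, if_pos]
    · rfl
    · intro l h1 h2
      exact H _ (by simpa using h1) (by dsimp only; omega)
    · intro l hl
      exact H l (by omega) (by omega)
  · rw [if_neg H]
    split_ifs with h1 h2
    · refine absurd (fun l hl1 hl2 => ?_) H
      by_cases hl : off ≤ (l : ℕ) ∧ (l : ℕ) < off + w
      · have := h2 ⟨l - off, by omega⟩ (by dsimp only; omega) (by dsimp only; omega)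
        have e : (⟨off + (l - off), by omega⟩ : Fin k) = l := by
          ext
          dsimp only
          omega
        simpa only [e] using this
      · exact h1 l hl
    · rfl
    · rfl

lemma windowEmb_matAt {off w : ℕ} (h : off + w ≤ k)
    (X : Matrix (Fin N) (Fin N) α) {j : ℕ} (hj : j < w) :
    windowEmb h (matAt N w X j) = matAt N k X (off + j) := by
  ext a b
  rw [windowEmb_apply, matAt, matAt, dif_pos hj, dif_pos (by omega)]
  simp only [Matrix.of_apply]
  by_cases H : ∀ l : Fin k, (l : ℕ) ≠ off + j → a l = b l
  · rw [if_pos H, if_pos, if_pos]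
    · intro l h1
      exact H _ (by simpa using h1)
    · intro l hl
      exact H l (by omega)
  · rw [if_neg H]
    split_ifs with h1 h2
    · refine absurd (fun l hl1 => ?_) H
      by_cases hl : off ≤ (l : ℕ) ∧ (l : ℕ) < off + w
      · have := h2 ⟨l - off, by omega⟩ (by dsimp only; omega)
        have e : (⟨off + (l - off), by omega⟩ : Fin k) = l := by
          ext
          dsimp only
          omega
        simpa only [e] using this
      · exact h1 l hl
    · rfl
    · rfl

lemma opAt_two (R : Matrix (Fin N × Fin N) (Fin N × Fin N) α) :
    opAt N 2 R 0 = R.submatrix (finTwoArrowEquiv (Fin N)) (finTwoArrowEquiv (Fin N)) := by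
  ext a b
  rw [opAt, dif_pos (by omega), Matrix.of_apply, if_pos]
  · rfl
  · intro l h1 h2
    omega

lemma matAt_one_site (X : Matrix (Fin N) (Fin N) α) :
    matAt N 1 X 0 =
      X.submatrix (Equiv.funUnique (Fin 1) (Fin N)) (Equiv.funUnique (Fin 1) (Fin N)) := by
  ext a b
  rw [matAt, dif_pos (by omega), Matrix.of_apply, if_pos]
  · rfl
  · intro l h1
    omega

lemma opAt_mul (R R' : Matrix (Fin N × Fin N) (Fin N × Fin N) α) (i : ℕ) :
    opAt N k (R * R') i = opAt N k R i * opAt N k R' i := by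
  by_cases h : i + 1 < k
  · have hk : i + 2 ≤ k := by omega
    have H := fun Q : Matrix (Fin N × Fin N) (Fin N × Fin N) α =>
      windowEmb_opAt hk Q (j := 0) (by omega)
    simp only [add_zero] at H
    simp only [← H, ← windowEmb_mul, opAt_two, Matrix.submatrix_mul_equiv]
  · simp [opAt, h]

lemma opAt_one (i : ℕ) :
    opAt N k (1 : Matrix (Fin N × Fin N) (Fin N × Fin N) α) i = 1 := by
  by_cases h : i + 1 < k
  · have hk : i + 2 ≤ k := by omega
    have H := windowEmb_opAt hk (1 : Matrix (Fin N × Fin N) (Fin N × Fin N) α) (j := 0) (by omega)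
    rw [add_zero] at H
    rw [← H, opAt_two, Matrix.submatrix_one_equiv, windowEmb_one]
  · simp [opAt, h]

lemma opAt_add (R R' : Matrix (Fin N × Fin N) (Fin N × Fin N) α) {i : ℕ} (h : i + 1 < k) :
    opAt N k (R + R') i = opAt N k R i + opAt N k R' i := by
  ext a b
  simp only [opAt, dif_pos h, Matrix.of_apply, Matrix.add_apply]
  split_ifs <;> simp

lemma opAt_smul {A : Type*} [Ring A] [Algebra ℂ A] (c : ℂ)
    (R : Matrix (Fin N × Fin N) (Fin N × Fin N) A) {i : ℕ} (h : i + 1 < k) :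
    opAt N k (c • R) i = c • opAt N k R i := by
  ext a b
  simp only [opAt, dif_pos h, Matrix.of_apply, Matrix.smul_apply]
  split_ifs <;> simp

lemma matAt_mul (X Y : Matrix (Fin N) (Fin N) α) (i : ℕ) :
    matAt N k (X * Y) i = matAt N k X i * matAt N k Y i := by
  by_cases h : i < k
  · have hk : i + 1 ≤ k := by omega
    have H := fun Q : Matrix (Fin N) (Fin N) α => windowEmb_matAt hk Q (j := 0) (by omega)
    simp only [add_zero] at H
    simp only [← H, ← windowEmb_mul, matAt_one_site, Matrix.submatrix_mul_equiv]
  · simp [matAt, h]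

lemma matAt_one (i : ℕ) : matAt N k (1 : Matrix (Fin N) (Fin N) α) i = 1 := by
  by_cases h : i < k
  · have hk : i + 1 ≤ k := by omega
    have H := windowEmb_matAt hk (1 : Matrix (Fin N) (Fin N) α) (j := 0) (by omega)
    rw [add_zero] at H
    rw [← H, matAt_one_site, Matrix.submatrix_one_equiv, windowEmb_one]
  · simp [matAt, h]

lemma matAt_one_sub_smul {A : Type*} [Ring A] [Algebra ℂ A] (c : ℂ)
    (X : Matrix (Fin N) (Fin N) A) {i : ℕ} (h : i < k) :
    matAt N k (1 - c • X) i = 1 - c • matAt N k X i := by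
  rw [← matAt_one (α := A) i]
  ext a b
  simp only [matAt, dif_pos h, Matrix.of_apply, Matrix.smul_apply, Matrix.sub_apply]
  split_ifs <;> simp

/-- Two matrices acting on disjoint sets of sites commute if their entries do. -/
lemma commute_of_disjoint {P Q : Fin k → Prop} (hPQ : ∀ l, P l → ¬ Q l)
    {X Y : Matrix (Fin k → Fin N) (Fin k → Fin N) α}
    (hX0 : ∀ a b, (∃ l, ¬ P l ∧ a l ≠ b l) → X a b = 0)
    (hY0 : ∀ a b, (∃ l, ¬ Q l ∧ a l ≠ b l) → Y a b = 0)
    (hX : ∀ a b a' b', (∀ l, P l → a l = a' l ∧ b l = b' l) → (∀ l, ¬ P l → a l = b l) →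
      (∀ l, ¬ P l → a' l = b' l) → X a b = X a' b')
    (hY : ∀ a b a' b', (∀ l, Q l → a l = a' l ∧ b l = b' l) → (∀ l, ¬ Q l → a l = b l) →
      (∀ l, ¬ Q l → a' l = b' l) → Y a b = Y a' b')
    (hc : ∀ a b c d, Commute (X a b) (Y c d)) : Commute X Y := by
  classical
  ext a b
  rw [Matrix.mul_apply, Matrix.mul_apply]
  by_cases hab : ∀ l, ¬ P l → ¬ Q l → a l = b l
  · rw [Finset.sum_eq_single (fun l => if P l then b l else a l),
      Finset.sum_eq_single (fun l => if P l then a l else b l)]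
    · rw [(hc _ _ _ _).eq]
      congr 1
      · apply hY
        · intro l hl
          have : ¬ P l := fun h => hPQ l h hl
          simp [this]
        · intro l hl
          by_cases hp : P l <;> simp [hp]
          exact hab l hp hl
        · intro l hl
          by_cases hp : P l <;> simp [hp]
          exact hab l hp hl
      · apply hX
        · intro l hl
          simp [hl]
        · intro l hl
          simp [hl]
        · intro l hl
          simp [hl]
    · intro c _ hne
      obtain ⟨l, hl⟩ := Function.ne_iff.1 hne
      by_cases hp : P l
      · rw [hY0 a c ⟨l, hPQ l hp, by simpa [hp, eq_comm] using hl⟩, zero_mul]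
      · rw [hX0 c b ⟨l, hp, by simpa [hp] using hl⟩, mul_zero]
    · simp
    · intro c _ hne
      obtain ⟨l, hl⟩ := Function.ne_iff.1 hne
      by_cases hp : P l
      · rw [hY0 c b ⟨l, hPQ l hp, by simpa [hp] using hl⟩, mul_zero]
      · rw [hX0 a c ⟨l, hp, by simpa [hp, eq_comm] using hl⟩, zero_mul]
    · simp
  · push Not at hab
    obtain ⟨l, hp, hq, hl⟩ := hab
    rw [Finset.sum_eq_zero, Finset.sum_eq_zero]
    · intro c _
      by_cases h : a l = c l
      · rw [hX0 c b ⟨l, hp, h ▸ hl⟩, mul_zero]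
      · rw [hY0 a c ⟨l, hq, h⟩, zero_mul]
    · intro c _
      by_cases h : a l = c l
      · rw [hY0 c b ⟨l, hq, h ▸ hl⟩, mul_zero]
      · rw [hX0 a c ⟨l, hp, h⟩, zero_mul]

lemma opAt_eq_zero (R : Matrix (Fin N × Fin N) (Fin N × Fin N) α) {i : ℕ} (h : i + 1 < k)
    (a b : Fin k → Fin N)
    (hab : ∃ l : Fin k, ¬ ((l : ℕ) = i ∨ (l : ℕ) = i + 1) ∧ a l ≠ b l) :
    opAt N k R i a b = 0 := by
  obtain ⟨l, hl, hne⟩ := hab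
  rw [opAt, dif_pos h, Matrix.of_apply, if_neg]
  exact fun H => hne (H l (by tauto) (by tauto))

lemma opAt_congr (R : Matrix (Fin N × Fin N) (Fin N × Fin N) α) {i : ℕ} (h : i + 1 < k)
    (a b a' b' : Fin k → Fin N)
    (hin : ∀ l : Fin k, (l : ℕ) = i ∨ (l : ℕ) = i + 1 → a l = a' l ∧ b l = b' l)
    (hab : ∀ l : Fin k, ¬ ((l : ℕ) = i ∨ (l : ℕ) = i + 1) → a l = b l)
    (hab' : ∀ l : Fin k, ¬ ((l : ℕ) = i ∨ (l : ℕ) = i + 1) → a' l = b' l) :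
    opAt N k R i a b = opAt N k R i a' b' := by
  rw [opAt, dif_pos h, Matrix.of_apply, Matrix.of_apply, if_pos, if_pos]
  · rw [(hin ⟨i, by omega⟩ (Or.inl rfl)).1, (hin ⟨i, by omega⟩ (Or.inl rfl)).2,
      (hin ⟨i + 1, h⟩ (Or.inr rfl)).1, (hin ⟨i + 1, h⟩ (Or.inr rfl)).2]
  · exact fun l h1 h2 => hab' l (by tauto)
  · exact fun l h1 h2 => hab l (by tauto)

lemma matAt_eq_zero (X : Matrix (Fin N) (Fin N) α) {i : ℕ} (h : i < k)
    (a b : Fin k → Fin N) (hab : ∃ l : Fin k, ¬ ((l : ℕ) = i) ∧ a l ≠ b l) :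
    matAt N k X i a b = 0 := by
  obtain ⟨l, hl, hne⟩ := hab
  rw [matAt, dif_pos h, Matrix.of_apply, if_neg]
  exact fun H => hne (H l hl)

lemma matAt_congr (X : Matrix (Fin N) (Fin N) α) {i : ℕ} (h : i < k)
    (a b a' b' : Fin k → Fin N)
    (hin : ∀ l : Fin k, (l : ℕ) = i → a l = a' l ∧ b l = b' l)
    (hab : ∀ l : Fin k, ¬ ((l : ℕ) = i) → a l = b l)
    (hab' : ∀ l : Fin k, ¬ ((l : ℕ) = i) → a' l = b' l) :
    matAt N k X i a b = matAt N k X i a' b' := by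
  rw [matAt, dif_pos h, Matrix.of_apply, Matrix.of_apply, if_pos, if_pos]
  · rw [(hin ⟨i, h⟩ rfl).1, (hin ⟨i, h⟩ rfl).2]
  · exact hab'
  · exact hab

end Window

section Numeric

variable {A : Type*} [Ring A] [Algebra ℂ A] {N k : ℕ}

lemma toA_mul {ι : Type*} [Fintype ι] (X Y : Matrix ι ι ℂ) :
    toA A (X * Y) = toA A X * toA A Y :=
  Matrix.map_mul

lemma toA_one {ι : Type*} [DecidableEq ι] : toA A (1 : Matrix ι ι ℂ) = 1 :=
  Matrix.map_one _ (map_zero _) (map_one _)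

lemma toA_opAt (R : Matrix (Fin N × Fin N) (Fin N × Fin N) ℂ) (i : ℕ) :
    toA A (opAt N k R i) = opAt N k (toA A R) i := by
  by_cases h : i + 1 < k
  · ext a b
    simp only [toA, opAt, dif_pos h, Matrix.map_apply, Matrix.of_apply]
    split_ifs <;> simp
  · simp only [opAt, dif_neg h, toA_one]

lemma commute_toA_apply {ι : Type*} (X : Matrix ι ι ℂ) (i j : ι) (x : A) :
    Commute (toA A X i j) x :=
  Algebra.commutes _ _

lemma mul_toA_mem_matrix {ι : Type*} [Fintype ι] [DecidableEq ι] (I : Ideal A) {X : Matrix ι ι A}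
    (hX : X ∈ I.matrix ι) (Y : Matrix ι ι ℂ) : X * toA A Y ∈ I.matrix ι := by
  intro a b
  rw [Matrix.mul_apply]
  refine sum_mem fun c _ => ?_
  rw [← (commute_toA_apply Y c b (X a c)).eq]
  exact I.mul_mem_left _ (hX a c)

lemma opAt_braidSystem {R Rinv : Matrix (Fin N × Fin N) (Fin N × Fin N) ℂ}
    (hRinv : R * Rinv = 1 ∧ Rinv * R = 1) (hbraid : IsBraid N R) :
    BraidSystem k (opAt N k (toA A R)) (opAt N k (toA A Rinv)) where
  mul_inv i := by rw [← opAt_mul, ← toA_mul, hRinv.1, toA_one, opAt_one]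
  inv_mul i := by rw [← opAt_mul, ← toA_mul, hRinv.2, toA_one, opAt_one]
  far i j hij := by
    by_cases hj : j + 1 < k
    · refine commute_of_disjoint (P := fun l => (l : ℕ) = i ∨ (l : ℕ) = i + 1)
        (Q := fun l => (l : ℕ) = j ∨ (l : ℕ) = j + 1) (fun l => by omega)
        (opAt_eq_zero _ (by omega)) (opAt_eq_zero _ hj) (opAt_congr _ (by omega))
        (opAt_congr _ hj) fun a b c d => ?_
      rw [← toA_opAt]
      exact commute_toA_apply _ _ _ _
    · rw [show opAt N k (toA A R) j = 1 from dif_neg hj]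
      exact Commute.one_right _
  braid i hi := by
    have H := congrArg (toA A) hbraid
    have hk : i + 3 ≤ k := by omega
    simp only [toA_mul, toA_opAt] at H
    have H := congrArg (windowEmb hk) H
    simpa only [windowEmb_mul, windowEmb_opAt hk _ (show 0 + 1 < 3 by omega),
      windowEmb_opAt hk _ (show 1 + 1 < 3 by omega), add_zero] using H

lemma commute_opAt_matAt (R : Matrix (Fin N × Fin N) (Fin N × Fin N) ℂ)
    (X : Matrix (Fin N) (Fin N) A) {i : ℕ} (hi : 1 ≤ i) :
    Commute (opAt N k (toA A R) i) (matAt N k X 0) := by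
  by_cases h : i + 1 < k
  · refine commute_of_disjoint (P := fun l => (l : ℕ) = i ∨ (l : ℕ) = i + 1)
      (Q := fun l => (l : ℕ) = 0) (fun l => by omega)
      (opAt_eq_zero _ h) (matAt_eq_zero _ (by omega)) (opAt_congr _ h)
      (matAt_congr _ (by omega)) fun a b c d => ?_
    rw [← toA_opAt]
    exact commute_toA_apply _ _ _ _
  · rw [show opAt N k (toA A R) i = 1 from dif_neg h]
    exact Commute.one_left _

/-- The Hecke condition in the form `R = R⁻¹ + (q − q⁻¹)`. -/
lemma IsHecke.eq_inv_add {q : ℂ} (hq : q ≠ 0)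
    {R Rinv : Matrix (Fin N × Fin N) (Fin N × Fin N) ℂ}
    (hRinv : R * Rinv = 1) (h : IsHecke N q R) :
    R = Rinv + (q - q⁻¹) • (1 : Matrix (Fin N × Fin N) (Fin N × Fin N) ℂ) := by
  have h1 : (1 : Matrix (Fin N × Fin N) (Fin N × Fin N) ℂ) + (q - q⁻¹) • R = R * R := by
    rw [IsHecke] at h
    simp only [sub_mul, mul_add, smul_mul_assoc, mul_smul_comm, one_mul, mul_one, smul_sub,
      smul_smul, inv_mul_cancel₀ hq, one_smul] at h
    rw [sub_smul, ← sub_eq_zero, ← h]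
    abel
  have h2 := congrArg (· * Rinv) h1
  simp only [add_mul, one_mul, smul_mul_assoc, mul_assoc, hRinv, mul_one] at h2
  exact h2.symm

/-- `K̂ = 1 − c·md` satisfies the permutation relation `K̂ r m r = r⁻¹ m r K̂`. -/
lemma one_sub_smul_mul_exchange {S : Type*} [Ring S] [Algebra ℂ S] {c : ℂ} {r ri m d : S}
    (h1 : r * ri = 1) (h2 : ri * r = 1) (hH : r = ri + c • 1)
    (hm : r * m * r * m = m * r * m * r)
    (hd : d * r * m * r = r * m * ri * d + r) :
    (1 - c • (m * d)) * r * m * r = ri * m * r * (1 - c • (m * d)) := by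
  have hm' : m * r * m * ri = ri * m * r * m := by
    calc m * r * m * ri = ri * (r * m * r * m) * ri := by
          simp only [← mul_assoc, h2, one_mul]
      _ = _ := by rw [hm]; simp only [mul_assoc, h1, mul_one]
  have e1 : m * d * r * m * r = ri * m * r * m * d + m * r := by
    calc m * d * r * m * r = m * (d * r * m * r) := by simp only [mul_assoc]
      _ = m * r * m * ri * d + m * r := by rw [hd, mul_add]; simp only [mul_assoc]
      _ = _ := by rw [hm']
  have e2 : r * m * r = ri * m * r + c • (m * r) := by
    conv_lhs => rw [mul_assoc, hH, add_mul, ← hH]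
    rw [smul_mul_assoc, one_mul, mul_assoc]
  simp only [sub_mul, mul_sub, one_mul, mul_one, smul_mul_assoc, mul_smul_comm, e1, e2, smul_add]
  simp only [mul_assoc]
  abel

end Numeric

lemma ovCopy_eq_sandwich {α : Type*} [Semiring α] (N k : ℕ)
    (R Rinv : Matrix (Fin N × Fin N) (Fin N × Fin N) α) (X : Matrix (Fin N) (Fin N) α) :
    ovCopy N k R Rinv X = sandwich (opAt N k R) (opAt N k Rinv) (matAt N k X 0) := by
  funext t
  induction t with
  | zero => rfl
  | succ t ih => rw [ovCopy, ih, sandwich]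

lemma unCopy_eq_sandwich {α : Type*} [Semiring α] (N k : ℕ)
    (R Rinv : Matrix (Fin N × Fin N) (Fin N × Fin N) α) (X : Matrix (Fin N) (Fin N) α) :
    unCopy N k R Rinv X = sandwich (opAt N k Rinv) (opAt N k R) (matAt N k X 0) := by
  funext t
  induction t with
  | zero => rfl
  | succ t ih => rw [unCopy, ih, sandwich]

lemma JMup_eq_sandwich {α : Type*} [Semiring α] (N k : ℕ)
    (R : Matrix (Fin N × Fin N) (Fin N × Fin N) α) (n : ℕ) :
    JMup N k R n = sandwich (fun i => opAt N k R (n + i)) (fun i => opAt N k R (n + i)) 1 := by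
  funext t
  induction t with
  | zero => rfl
  | succ t ih => rw [JMup, ih, sandwich]

lemma prod_map_range'_two {S : Type*} [Monoid S] (f : ℕ → S) (h0 : f 0 = 1) {p : ℕ}
    (hp : 1 ≤ p) :
    ((List.range' 2 (p - 1)).map (fun s => f (s - 1))).prod = ((List.range p).map f).prod := by
  obtain ⟨p, rfl⟩ := Nat.exists_eq_add_of_le' hp
  rw [List.range_succ_eq_map, List.map_cons, List.prod_cons, h0, one_mul, List.range'_eq_map_range,
    List.map_map, List.map_map]
  congr 1
  refine List.map_congr_left fun i _ => ?_
  simp only [Function.comp_apply]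
  congr 1
  omega

/-- With `K̂ = I − (q − q⁻¹)·MD`, for all `n, p ≥ 1` the action formula
`K̂_{[(n+p)→(n+1)]} · M_{⟨1→n⟩} = (∏_{i=1}^{p} J⁻¹_{n+i}) (∏_{s=2}^{p} J_s^{↑n}) · M_{⟨1→n⟩}`
holds modulo the left ideal generated by the entries of `D`. -/
theorem stmt9 {A : Type*} [Ring A] [Algebra ℂ A] (N : ℕ) (hN : 1 ≤ N) (q : ℂ)
    (hq : GenericQ q)
    (R Rinv : Matrix (Fin N × Fin N) (Fin N × Fin N) ℂ)
    (hRinv : R * Rinv = 1 ∧ Rinv * R = 1)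
    (hbraid : IsBraid N R) (hHecke : IsHecke N q R)
    (M D : Matrix (Fin N) (Fin N) A)
    (hM : RErel N (toA A R) M)
    (hD : RErel N (toA A Rinv) D)
    (hDM : PermRel N R Rinv M D)
    (n p : ℕ) (hn : 1 ≤ n) (hp : 1 ≤ p) :
    ∀ a b : Fin (n + p) → Fin N,
      (((List.range' n p).reverse.map
            (unCopy N (n + p) (toA A R) (toA A Rinv)
              ((1 : Matrix (Fin N) (Fin N) A) - (q - q⁻¹) • (M * D)))).prod *
          ovProd N (n + p) (toA A R) (toA A Rinv) M n -
        ((List.range p).map (fun i => JMup N (n + p) (toA A Rinv) 0 (n + i))).prod *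
          ((List.range' 2 (p - 1)).map (fun s => JMup N (n + p) (toA A R) n (s - 1))).prod *
          ovProd N (n + p) (toA A R) (toA A Rinv) M n) a b ∈ entryIdeal A D := by
  have hk : 0 + 2 ≤ n + p := by omega
  have hB : BraidSystem (n + p) (opAt N (n + p) (toA A R)) (opAt N (n + p) (toA A Rinv)) :=
    opAt_braidSystem hRinv hbraid
  have hE : ∀ Q : Matrix (Fin N × Fin N) (Fin N × Fin N) A,
      windowEmb hk (opAt N 2 Q 0) = opAt N (n + p) Q 0 := fun Q => by
    rw [windowEmb_opAt hk Q (by omega)]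
  have hE' : ∀ X : Matrix (Fin N) (Fin N) A,
      windowEmb hk (matAt N 2 X 0) = matAt N (n + p) X 0 := fun X => by
    rw [windowEmb_matAt hk X (by omega)]
  have hm := congrArg (windowEmb hk) hM
  have hd := congrArg (windowEmb hk) hDM
  simp only [windowEmb_mul, windowEmb_add, hE, hE'] at hm hd
  have hH : opAt N (n + p) (toA A R) 0 = opAt N (n + p) (toA A Rinv) 0 + (q - q⁻¹) • 1 := by
    have h := congrArg (toA A) (hHecke.eq_inv_add hq.1 hRinv.1)
    have h' : toA A (Rinv + (q - q⁻¹) • (1 : Matrix (Fin N × Fin N) (Fin N × Fin N) ℂ)) =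
        toA A Rinv + (q - q⁻¹) • (1 : Matrix (Fin N × Fin N) (Fin N × Fin N) A) := by
      ext a b
      by_cases hab : a = b <;>
        simp [toA, Matrix.map_apply, Matrix.add_apply, Matrix.smul_apply, hab,
          Algebra.algebraMap_eq_smul_one, add_smul]
    rw [h'] at h
    rw [h, opAt_add _ _ (by omega), opAt_smul _ _ (by omega), opAt_one]
  have hκ : matAt N (n + p) ((1 : Matrix (Fin N) (Fin N) A) - (q - q⁻¹) • (M * D)) 0 =
      1 - (q - q⁻¹) • (matAt N (n + p) M 0 * matAt N (n + p) D 0) := by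
    rw [matAt_one_sub_smul _ _ (by omega), matAt_mul]
  have hrel := one_sub_smul_mul_exchange (hB.mul_inv 0) (hB.inv_mul 0) hH hm hd
  rw [← hκ] at hrel
  have hDmem : matAt N (n + p) D 0 ∈ Ideal.matrix (Fin (n + p) → Fin N) (entryIdeal A D) := by
    intro a b
    rw [matAt, dif_pos (by omega), Matrix.of_apply]
    split_ifs
    · exact Submodule.subset_span ⟨_, _, rfl⟩
    · exact Submodule.zero_mem _
  have hκ1 : matAt N (n + p) ((1 : Matrix (Fin N) (Fin N) A) - (q - q⁻¹) • (M * D)) 0 - 1 ∈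
      Ideal.matrix (Fin (n + p) → Fin N) (entryIdeal A D) := by
    rw [hκ, sub_sub_cancel_left, ← smul_mul_assoc, ← neg_mul]
    exact Ideal.mul_mem_left _ _ hDmem
  have key := hB.prod_unCopy_mul_prod_mem (Ideal.matrix (Fin (n + p) → Fin N) (entryIdeal A D))
    (fun x hx i => by rw [← toA_opAt]; exact mul_toA_mem_matrix _ hx _)
    (fun x hx i => by rw [← toA_opAt]; exact mul_toA_mem_matrix _ hx _)
    hκ1 (fun i hi => commute_opAt_matAt R M hi) (fun i hi => commute_opAt_matAt R _ hi)
    hrel n p le_rfl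
  rw [prod_map_range'_two (JMup N (n + p) (toA A R) n) rfl hp, ovProd, unCopy_eq_sandwich,
    ovCopy_eq_sandwich, JMup_eq_sandwich, JMup_eq_sandwich]
  simp only [zero_add]
  exact key
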